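/- Let g(β,γ,μ) = 8μγ⁶ − (24μ²−4)γ⁵ + (30μ²+24β²−15)μγ⁴ − (20μ⁴+(48β²+3)μ²−8β²−3)γ³ + (7μ⁵+(36β²+45)μ³+(24β⁴−10β²−2)μ)γ² − (μ⁶+(12β²+44)μ⁴+(24β⁴+19β²+2)μ²−4β⁴−3β²+1)γ + (β²+13)μ⁵+(6β⁴+19β²+1)μ³+(8β⁶+5β⁴−2β²+1)μ, and f(β,γ) = 2μγ⁴ − (4μ²−1)γ³ + (3μ²+4β²−6)μγ² − (μ⁴+(4β²−7)μ²−β²−1)γ + (β²−2)μ³ + (2β⁴−2β²−1)μ. Then the resultant of f and g with respect to γ equals 202500(μ²−1)⁴β⁴μ⁶(4μ²β²+(μ²−1)²)². -/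

import Mathlib

/-- Coefficients of f(β,γ) = 2μγ⁴ − (4μ²−1)γ³ + (3μ²+4β²−6)μγ² −
(μ⁴+(4β²−7)μ²−β²−1)γ + (β²−2)μ³ + (2β⁴−2β²−1)μ, as a polynomial in γ. -/
noncomputable def fCoeff (β μ : ℝ) (k : ℤ) : ℝ :=
  if k = 0 then (β^2 - 2)*μ^3 + (2*β^4 - 2*β^2 - 1)*μ
  else if k = 1 then -(μ^4 + (4*β^2 - 7)*μ^2 - β^2 - 1)
  else if k = 2 then (3*μ^2 + 4*β^2 - 6)*μ
  else if k = 3 then -(4*μ^2 - 1)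
  else if k = 4 then 2*μ
  else 0

/-- Coefficients of g(β,γ,μ) (equation (3.15) of the paper) as a polynomial in γ. -/
noncomputable def gCoeff (β μ : ℝ) (k : ℤ) : ℝ :=
  if k = 0 then (β^2 + 13)*μ^5 + (6*β^4 + 19*β^2 + 1)*μ^3 + (8*β^6 + 5*β^4 - 2*β^2 + 1)*μ
  else if k = 1 then -(μ^6 + (12*β^2 + 44)*μ^4 + (24*β^4 + 19*β^2 + 2)*μ^2 - 4*β^4 - 3*β^2 + 1)
  else if k = 2 then 7*μ^5 + (36*β^2 + 45)*μ^3 + (24*β^4 - 10*β^2 - 2)*μ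
  else if k = 3 then -(20*μ^4 + (48*β^2 + 3)*μ^2 - 8*β^2 - 3)
  else if k = 4 then (30*μ^2 + 24*β^2 - 15)*μ
  else if k = 5 then -(24*μ^2 - 4)
  else if k = 6 then 8*μ
  else 0

/-- The Sylvester matrix of f (degree 4 in γ) and g (degree 6 in γ):
6 rows of shifted coefficients of f followed by 4 rows of shifted coefficients of g,
written in descending order. Its determinant is the resultant of f and g
with respect to γ. -/
noncomputable def sylvesterFG (β μ : ℝ) : Matrix (Fin 10) (Fin 10) ℝ :=
  Matrix.of fun i j =>
    if (i : ℕ) < 6 then fCoeff β μ (4 - ((j : ℤ) - (i : ℤ)))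
    else gCoeff β μ (6 - ((j : ℤ) - ((i : ℤ) - 6)))

theorem fourBlock_det (A : Matrix (Fin 6) (Fin 6) ℝ) (B : Matrix (Fin 6) (Fin 4) ℝ)
    (C X : Matrix (Fin 4) (Fin 6) ℝ) (E Y D : Matrix (Fin 4) (Fin 4) ℝ)
    (h1 : X * A + Y * C = 0) (h2 : X * B + Y * E = D) :
    Y.det * (Matrix.fromBlocks A B C E).det = A.det * D.det := by
  have h : Matrix.fromBlocks 1 0 X Y * Matrix.fromBlocks A B C E
      = Matrix.fromBlocks A B 0 D := by
    rw [Matrix.fromBlocks_multiply]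
    simp [h1, h2]
  have h' := congrArg Matrix.det h
  rw [Matrix.det_mul, Matrix.det_fromBlocks_zero₁₂, Matrix.det_fromBlocks_zero₂₁] at h'
  simpa using h'

theorem det_four (M : Matrix (Fin 4) (Fin 4) ℝ) : M.det =
    (M 0 0 * M 1 1 - M 0 1 * M 1 0) * (M 2 2 * M 3 3 - M 2 3 * M 3 2)
    - (M 0 0 * M 1 2 - M 0 2 * M 1 0) * (M 2 1 * M 3 3 - M 2 3 * M 3 1)
    + (M 0 0 * M 1 3 - M 0 3 * M 1 0) * (M 2 1 * M 3 2 - M 2 2 * M 3 1)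
    + (M 0 1 * M 1 2 - M 0 2 * M 1 1) * (M 2 0 * M 3 3 - M 2 3 * M 3 0)
    - (M 0 1 * M 1 3 - M 0 3 * M 1 1) * (M 2 0 * M 3 2 - M 2 2 * M 3 0)
    + (M 0 2 * M 1 3 - M 0 3 * M 1 2) * (M 2 0 * M 3 1 - M 2 1 * M 3 0) := by
  rw [Matrix.det_succ_row_zero]
  simp [Fin.sum_univ_succ, Matrix.det_fin_three, Matrix.submatrix_apply, Fin.succAbove]
  ring

set_option maxHeartbeats 4000000 in
/-- Elimination of the top of `g = q f + r` in the Sylvester matrix of `f` and `g`. -/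
theorem sylvester_elim (a0 a1 a2 a3 a4 g0 g1 g2 g3 g4 g5 g6 q0 q1 q2 r0 r1 r2 r3 : ℝ)
    (h0 : g0 = q0*a0 + r0)
    (h1 : g1 = q0*a1 + q1*a0 + r1)
    (h2 : g2 = q0*a2 + q1*a1 + q2*a0 + r2)
    (h3 : g3 = q0*a3 + q1*a2 + q2*a1 + r3)
    (h4 : g4 = q0*a4 + q1*a3 + q2*a2)
    (h5 : g5 = q1*a4 + q2*a3)
    (h6 : g6 = q2*a4) :
    a4^3 * (Matrix.fromBlocks
    !![a4, a3, a2, a1, a0, 0;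
     0, a4, a3, a2, a1, a0;
     0, 0, a4, a3, a2, a1;
     0, 0, 0, a4, a3, a2;
     0, 0, 0, 0, a4, a3;
     0, 0, 0, 0, 0, a4]
    !![0, 0, 0, 0;
     0, 0, 0, 0;
     a0, 0, 0, 0;
     a1, a0, 0, 0;
     a2, a1, a0, 0;
     a3, a2, a1, a0]
    !![g6, g5, g4, g3, g2, g1;
     0, g6, g5, g4, g3, g2;
     0, 0, g6, g5, g4, g3;
     0, 0, 0, g6, g5, g4]
    !![g0, 0, 0, 0;
     g1, g0, 0, 0;
     g2, g1, g0, 0;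
     g3, g2, g1, g0]).det =
    a4^6 * (Matrix.det
    !![a1*r3 + a2*r2 + a3*r1 + a4*r0 - r1*a3 - r2*a2 - r3*a1, a1*r2 + a2*r1 + a3*r0 - r1*a2 - r2*a1 - r3*a0, a1*r1 + a2*r0 - r1*a1 - r2*a0, a1*r0 - r1*a0;
     a2*r3 + a3*r2 + a4*r1 - r2*a3 - r3*a2, a2*r2 + a3*r1 + a4*r0 - r2*a2 - r3*a1, a2*r1 + a3*r0 - r2*a1 - r3*a0, a2*r0 - r2*a0;
     a3*r3 + a4*r2 - r3*a3, a3*r2 + a4*r1 - r3*a2, a3*r1 + a4*r0 - r3*a1, a3*r0 - r3*a0;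
     1*r3, 1*r2, 1*r1, 1*r0]) := by
  have key := fourBlock_det
    !![a4, a3, a2, a1, a0, 0;
     0, a4, a3, a2, a1, a0;
     0, 0, a4, a3, a2, a1;
     0, 0, 0, a4, a3, a2;
     0, 0, 0, 0, a4, a3;
     0, 0, 0, 0, 0, a4]
    !![0, 0, 0, 0;
     0, 0, 0, 0;
     a0, 0, 0, 0;
     a1, a0, 0, 0;
     a2, a1, a0, 0;
     a3, a2, a1, a0]
    !![g6, g5, g4, g3, g2, g1;
     0, g6, g5, g4, g3, g2;
     0, 0, g6, g5, g4, g3;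
     0, 0, 0, g6, g5, g4]
    !![-(a4*q2), -(a3*q2 + a4*q1), -(a2*q2 + a3*q1 + a4*q0), -(a1*q2 + a2*q1 + a3*q0 + r3), -(a1*q1 + a2*q0 + r2), -(a1*q0 + r1);
     0, -(a4*q2), -(a3*q2 + a4*q1), -(a2*q2 + a3*q1 + a4*q0), -(a2*q1 + a3*q0 + r3), -(a2*q0 + r2);
     0, 0, -(a4*q2), -(a3*q2 + a4*q1), -(a3*q1 + a4*q0), -(a3*q0 + r3);
     0, 0, 0, -(1*q2), -(1*q1), -(1*q0)]
    !![g0, 0, 0, 0;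
     g1, g0, 0, 0;
     g2, g1, g0, 0;
     g3, g2, g1, g0]
    !![a4, a3, a2, a1;
     0, a4, a3, a2;
     0, 0, a4, a3;
     0, 0, 0, 1]
    !![a1*r3 + a2*r2 + a3*r1 + a4*r0 - r1*a3 - r2*a2 - r3*a1, a1*r2 + a2*r1 + a3*r0 - r1*a2 - r2*a1 - r3*a0, a1*r1 + a2*r0 - r1*a1 - r2*a0, a1*r0 - r1*a0;
     a2*r3 + a3*r2 + a4*r1 - r2*a3 - r3*a2, a2*r2 + a3*r1 + a4*r0 - r2*a2 - r3*a1, a2*r1 + a3*r0 - r2*a1 - r3*a0, a2*r0 - r2*a0;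
     a3*r3 + a4*r2 - r3*a3, a3*r2 + a4*r1 - r3*a2, a3*r1 + a4*r0 - r3*a1, a3*r0 - r3*a0;
     1*r3, 1*r2, 1*r1, 1*r0]
    (by
      subst h0 h1 h2 h3 h4 h5 h6
      ext i j
      fin_cases i <;> fin_cases j <;>
        simp [Matrix.mul_apply, Fin.sum_univ_succ] <;> try ring)
    (by
      subst h0 h1 h2 h3 h4 h5 h6
      ext i j
      fin_cases i <;> fin_cases j <;>
        simp [Matrix.mul_apply, Fin.sum_univ_succ] <;> try ring)
  have hA : (Matrix.det
    !![a4, a3, a2, a1, a0, 0;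
     0, a4, a3, a2, a1, a0;
     0, 0, a4, a3, a2, a1;
     0, 0, 0, a4, a3, a2;
     0, 0, 0, 0, a4, a3;
     0, 0, 0, 0, 0, a4]) = a4^6 := by
    rw [Matrix.det_of_isUpperTriangular]
    · simp [Fin.prod_univ_succ]; ring
    · intro i j hij
      fin_cases i <;> fin_cases j <;> first | rfl | (exact absurd hij (by decide))
  have hY : (Matrix.det
    !![a4, a3, a2, a1;
     0, a4, a3, a2;
     0, 0, a4, a3;
     0, 0, 0, 1]) = a4^3 := by
    rw [Matrix.det_of_isUpperTriangular]
    · simp [Fin.prod_univ_succ]; ring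
    · intro i j hij
      fin_cases i <;> fin_cases j <;> first | rfl | (exact absurd hij (by decide))
  rw [hA, hY] at key
  exact key

set_option maxHeartbeats 4000000 in
theorem sylvesterFG_blocks (β μ : ℝ) : (sylvesterFG β μ).submatrix
    (finSumFinEquiv : Fin 6 ⊕ Fin 4 ≃ Fin 10) (finSumFinEquiv : Fin 6 ⊕ Fin 4 ≃ Fin 10) =
    Matrix.fromBlocks
    !![fCoeff β μ 4, fCoeff β μ 3, fCoeff β μ 2, fCoeff β μ 1, fCoeff β μ 0, 0;
     0, fCoeff β μ 4, fCoeff β μ 3, fCoeff β μ 2, fCoeff β μ 1, fCoeff β μ 0;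
     0, 0, fCoeff β μ 4, fCoeff β μ 3, fCoeff β μ 2, fCoeff β μ 1;
     0, 0, 0, fCoeff β μ 4, fCoeff β μ 3, fCoeff β μ 2;
     0, 0, 0, 0, fCoeff β μ 4, fCoeff β μ 3;
     0, 0, 0, 0, 0, fCoeff β μ 4]
    !![0, 0, 0, 0;
     0, 0, 0, 0;
     fCoeff β μ 0, 0, 0, 0;
     fCoeff β μ 1, fCoeff β μ 0, 0, 0;
     fCoeff β μ 2, fCoeff β μ 1, fCoeff β μ 0, 0;
     fCoeff β μ 3, fCoeff β μ 2, fCoeff β μ 1, fCoeff β μ 0]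
    !![gCoeff β μ 6, gCoeff β μ 5, gCoeff β μ 4, gCoeff β μ 3, gCoeff β μ 2, gCoeff β μ 1;
     0, gCoeff β μ 6, gCoeff β μ 5, gCoeff β μ 4, gCoeff β μ 3, gCoeff β μ 2;
     0, 0, gCoeff β μ 6, gCoeff β μ 5, gCoeff β μ 4, gCoeff β μ 3;
     0, 0, 0, gCoeff β μ 6, gCoeff β μ 5, gCoeff β μ 4]
    !![gCoeff β μ 0, 0, 0, 0;
     gCoeff β μ 1, gCoeff β μ 0, 0, 0;
     gCoeff β μ 2, gCoeff β μ 1, gCoeff β μ 0, 0;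
     gCoeff β μ 3, gCoeff β μ 2, gCoeff β μ 1, gCoeff β μ 0] := by
  ext i j
  rcases i with i | i <;> rcases j with j | j
  · change (if (i : ℕ) < 6 then fCoeff β μ (4 - (((j : ℕ) : ℤ) - ((i : ℕ) : ℤ)))
      else gCoeff β μ (6 - (((j : ℕ) : ℤ) - (((i : ℕ) : ℤ) - 6)))) =
      (!![fCoeff β μ 4, fCoeff β μ 3, fCoeff β μ 2, fCoeff β μ 1, fCoeff β μ 0, 0;
     0, fCoeff β μ 4, fCoeff β μ 3, fCoeff β μ 2, fCoeff β μ 1, fCoeff β μ 0;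
     0, 0, fCoeff β μ 4, fCoeff β μ 3, fCoeff β μ 2, fCoeff β μ 1;
     0, 0, 0, fCoeff β μ 4, fCoeff β μ 3, fCoeff β μ 2;
     0, 0, 0, 0, fCoeff β μ 4, fCoeff β μ 3;
     0, 0, 0, 0, 0, fCoeff β μ 4] : Matrix _ _ ℝ) i j
    fin_cases i <;> fin_cases j <;> simp [fCoeff, gCoeff]
  · change (if (i : ℕ) < 6 then fCoeff β μ (4 - (((6 + (j : ℕ) : ℕ) : ℤ) - ((i : ℕ) : ℤ)))
      else gCoeff β μ (6 - (((6 + (j : ℕ) : ℕ) : ℤ) - (((i : ℕ) : ℤ) - 6)))) =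
      (!![0, 0, 0, 0;
     0, 0, 0, 0;
     fCoeff β μ 0, 0, 0, 0;
     fCoeff β μ 1, fCoeff β μ 0, 0, 0;
     fCoeff β μ 2, fCoeff β μ 1, fCoeff β μ 0, 0;
     fCoeff β μ 3, fCoeff β μ 2, fCoeff β μ 1, fCoeff β μ 0] : Matrix _ _ ℝ) i j
    fin_cases i <;> fin_cases j <;> simp [fCoeff, gCoeff]
  · change (if (6 + (i : ℕ)) < 6 then fCoeff β μ (4 - (((j : ℕ) : ℤ) - ((6 + (i : ℕ) : ℕ) : ℤ)))
      else gCoeff β μ (6 - (((j : ℕ) : ℤ) - (((6 + (i : ℕ) : ℕ) : ℤ) - 6)))) =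
      (!![gCoeff β μ 6, gCoeff β μ 5, gCoeff β μ 4, gCoeff β μ 3, gCoeff β μ 2, gCoeff β μ 1;
     0, gCoeff β μ 6, gCoeff β μ 5, gCoeff β μ 4, gCoeff β μ 3, gCoeff β μ 2;
     0, 0, gCoeff β μ 6, gCoeff β μ 5, gCoeff β μ 4, gCoeff β μ 3;
     0, 0, 0, gCoeff β μ 6, gCoeff β μ 5, gCoeff β μ 4] : Matrix _ _ ℝ) i j
    fin_cases i <;> fin_cases j <;> simp [fCoeff, gCoeff]
  · change (if (6 + (i : ℕ)) < 6 then fCoeff β μ (4 - (((6 + (j : ℕ) : ℕ) : ℤ) - ((6 + (i : ℕ) : ℕ) : ℤ)))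
      else gCoeff β μ (6 - (((6 + (j : ℕ) : ℕ) : ℤ) - (((6 + (i : ℕ) : ℕ) : ℤ) - 6)))) =
      (!![gCoeff β μ 0, 0, 0, 0;
     gCoeff β μ 1, gCoeff β μ 0, 0, 0;
     gCoeff β μ 2, gCoeff β μ 1, gCoeff β μ 0, 0;
     gCoeff β μ 3, gCoeff β μ 2, gCoeff β μ 1, gCoeff β μ 0] : Matrix _ _ ℝ) i j
    fin_cases i <;> fin_cases j <;> simp [fCoeff, gCoeff]

set_option maxHeartbeats 4000000 in
theorem stmt_13 (β μ : ℝ) :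
    (sylvesterFG β μ).det
      = 202500*(μ^2 - 1)^4*β^4*μ^6*(4*μ^2*β^2 + (μ^2 - 1)^2)^2 := by
  by_cases hμ : μ = 0
  · subst hμ
    rw [Matrix.det_eq_zero_of_column_eq_zero 0]
    · simp
    · intro i
      fin_cases i <;> simp [sylvesterFG, fCoeff, gCoeff]
  have key := sylvester_elim (fCoeff β μ 0) (fCoeff β μ 1) (fCoeff β μ 2) (fCoeff β μ 3) (fCoeff β μ 4)
    (gCoeff β μ 0) (gCoeff β μ 1) (gCoeff β μ 2) (gCoeff β μ 3) (gCoeff β μ 4) (gCoeff β μ 5) (gCoeff β μ 6)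
    (μ^2 + 4*β^2 + 13/2)
    (-4*μ)
    (4)
    (15/2*μ + 15*μ^3 + 15*μ^5 + 15*β^2*μ + 45/2*β^2*μ^3)
    (-15/2 - 105/2*μ^2 - 105/2*μ^4 - 15/2*β^2 - 30*β^2*μ^2)
    (45*μ + 135/2*μ^3)
    (-15/2 - 30*μ^2)
    (by simp [fCoeff, gCoeff]; ring) (by simp [fCoeff, gCoeff]; ring)
    (by simp [fCoeff, gCoeff]; ring) (by simp [fCoeff, gCoeff]; ring)
    (by simp [fCoeff, gCoeff]; ring) (by simp [fCoeff, gCoeff]; ring)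
    (by simp [fCoeff, gCoeff]; ring)
  rw [← sylvesterFG_blocks, Matrix.det_submatrix_equiv_self, det_four] at key
  have e4 : fCoeff β μ 4 = 2*μ := by simp [fCoeff]
  have hne : (fCoeff β μ 4)^3 ≠ 0 := by rw [e4]; positivity
  apply mul_left_cancel₀ hne
  rw [key]
  simp [fCoeff]
  ring
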